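/- For all integers k,s ≥ 1 and c ∈ {0,1}, the set 𝓩 = {1, (αβγ)^i + (βγα)^i + (γαβ)^i (1 ≤ i ≤ k−1), (βγα)^{k−1}βγ, (αβγ)^k, η^j (1 ≤ j ≤ s)} is an F-basis of the center Z(A^{k,s}_c); in particular dim_F Z(A^{k,s}_c) = k + s + 2. -/

import Mathlib

/- Common setup: the algebras D(2B)^{k,s}(c) of dihedral type, over a field F,
   presented as a quotient of the free algebra on the paths-generators
   e₁, e₂ (trivial paths), α (loop at vertex 1), β (arrow 1 → 2),
   γ (arrow 2 → 1), η (loop at vertex 2), by the path-algebra relations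
   together with Erdmann's relations
   βη = 0, ηγ = 0, γβ = 0, α² = c(αβγ)^k, (αβγ)^k = (βγα)^k, η^s = (γαβ)^k. -/

noncomputable section

namespace DihedralPaper

inductive Gen : Type
  | e1 | e2 | a | b | g | h

variable (F : Type) [Field F]

/-- The generators inside the free algebra. -/
def gen (t : Gen) : FreeAlgebra F Gen := FreeAlgebra.ι F t

/-- The defining relations of `D(2B)^{k,s}(c)` (paths written from left to right). -/
inductive Rel (k s : ℕ) (c : F) : FreeAlgebra F Gen → FreeAlgebra F Gen → Prop
  | unit : Rel k s c (gen F .e1 + gen F .e2) 1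
  | idem1 : Rel k s c (gen F .e1 * gen F .e1) (gen F .e1)
  | idem2 : Rel k s c (gen F .e2 * gen F .e2) (gen F .e2)
  | orth12 : Rel k s c (gen F .e1 * gen F .e2) 0
  | orth21 : Rel k s c (gen F .e2 * gen F .e1) 0
  | aL : Rel k s c (gen F .e1 * gen F .a) (gen F .a)
  | aR : Rel k s c (gen F .a * gen F .e1) (gen F .a)
  | bL : Rel k s c (gen F .e1 * gen F .b) (gen F .b)
  | bR : Rel k s c (gen F .b * gen F .e2) (gen F .b)
  | gL : Rel k s c (gen F .e2 * gen F .g) (gen F .g)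
  | gR : Rel k s c (gen F .g * gen F .e1) (gen F .g)
  | hL : Rel k s c (gen F .e2 * gen F .h) (gen F .h)
  | hR : Rel k s c (gen F .h * gen F .e2) (gen F .h)
  | bh : Rel k s c (gen F .b * gen F .h) 0
  | hg : Rel k s c (gen F .h * gen F .g) 0
  | gb : Rel k s c (gen F .g * gen F .b) 0
  | asq : Rel k s c (gen F .a * gen F .a) (c • (gen F .a * gen F .b * gen F .g) ^ k)
  | abg : Rel k s c ((gen F .a * gen F .b * gen F .g) ^ k) ((gen F .b * gen F .g * gen F .a) ^ k)
  | hs : Rel k s c ((gen F .h) ^ s) ((gen F .g * gen F .a * gen F .b) ^ k)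

/-- The algebra `A^{k,s}_c = D(2B)^{k,s}(c)`. -/
def DA (k s : ℕ) (c : F) : Type := RingQuot (Rel F k s c)

instance (k s : ℕ) (c : F) : Ring (DA F k s c) :=
  inferInstanceAs (Ring (RingQuot (Rel F k s c)))

instance (k s : ℕ) (c : F) : Algebra F (DA F k s c) :=
  inferInstanceAs (Algebra F (RingQuot (Rel F k s c)))

variable (k s : ℕ) (c : F)

/-- The canonical projection. -/
def mk : FreeAlgebra F Gen →ₐ[F] DA F k s c := RingQuot.mkAlgHom F (Rel F k s c)

def E1 : DA F k s c := mk F k s c (gen F .e1)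
def E2 : DA F k s c := mk F k s c (gen F .e2)
/-- The image of the loop α at vertex 1. -/
def Al : DA F k s c := mk F k s c (gen F .a)
/-- The image of the arrow β : 1 → 2. -/
def Be : DA F k s c := mk F k s c (gen F .b)
/-- The image of the arrow γ : 2 → 1. -/
def Ga : DA F k s c := mk F k s c (gen F .g)
/-- The image of the loop η at vertex 2. -/
def Et : DA F k s c := mk F k s c (gen F .h)

/-- The path αβγ. -/
def ABG : DA F k s c := Al F k s c * Be F k s c * Ga F k s c
/-- The path βγα. -/
def BGA : DA F k s c := Be F k s c * Ga F k s c * Al F k s c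
/-- The path γαβ. -/
def GAB : DA F k s c := Ga F k s c * Al F k s c * Be F k s c

/-- The standard basis paths 𝓑₁₁ of e₁Ae₁. -/
def B11 : Set (DA F k s c) :=
  {E1 F k s c, Al F k s c, Be F k s c * Ga F k s c, (ABG F k s c) ^ k}
    ∪ (fun i => (ABG F k s c) ^ i) '' Set.Icc 1 (k - 1)
    ∪ (fun i => (ABG F k s c) ^ i * Al F k s c) '' Set.Icc 1 (k - 1)
    ∪ (fun i => (BGA F k s c) ^ i) '' Set.Icc 1 (k - 1)
    ∪ (fun i => (BGA F k s c) ^ i * (Be F k s c * Ga F k s c)) '' Set.Icc 1 (k - 1)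

/-- The standard basis paths 𝓑₁₂ of e₁Ae₂. -/
def B12 : Set (DA F k s c) :=
  {Be F k s c, Al F k s c * Be F k s c}
    ∪ (fun i => (BGA F k s c) ^ i * Be F k s c) '' Set.Icc 1 (k - 1)
    ∪ (fun i => (ABG F k s c) ^ i * (Al F k s c * Be F k s c)) '' Set.Icc 1 (k - 1)

/-- The standard basis paths 𝓑₂₁ of e₂Ae₁. -/
def B21 : Set (DA F k s c) :=
  {Ga F k s c, Ga F k s c * Al F k s c}
    ∪ (fun i => (GAB F k s c) ^ i * Ga F k s c) '' Set.Icc 1 (k - 1)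
    ∪ (fun i => (GAB F k s c) ^ i * (Ga F k s c * Al F k s c)) '' Set.Icc 1 (k - 1)

/-- The standard basis paths 𝓑₂₂ of e₂Ae₂. -/
def B22 : Set (DA F k s c) :=
  {E2 F k s c}
    ∪ (fun i => (GAB F k s c) ^ i) '' Set.Icc 1 (k - 1)
    ∪ (fun j => (Et F k s c) ^ j) '' Set.Icc 1 s

/-- The standard path basis 𝓑 of `A^{k,s}_c`. -/
def BB : Set (DA F k s c) :=
  B11 F k s c ∪ B12 F k s c ∪ B21 F k s c ∪ B22 F k s c

/-- The commutator subspace K(A): the F-linear span of all commutators. -/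
def Kspan (A : Type) [Ring A] [Algebra F A] : Submodule F A :=
  Submodule.span F {z : A | ∃ u v : A, z = u * v - v * u}

/-- The (left) socle of a ring: the sum of all simple (left) submodules. -/
def socle (A : Type) [Ring A] : Submodule A A := sSup {S : Submodule A A | IsAtom S}

/-- `ψ` is the linear form sending each standard basis path lying in the socle to 1
    and every other standard basis path to 0. -/
def SoclePsi (ψ : DA F k s c →ₗ[F] F) : Prop :=
  ∀ p ∈ BB F k s c,
    (p ∈ socle (DA F k s c) → ψ p = 1) ∧ (p ∉ socle (DA F k s c) → ψ p = 0)

/-- `T₁(A) = {x : x² ∈ K(A)}`. -/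
def T1set : Set (DA F k s c) := {z | z ^ 2 ∈ Kspan F (DA F k s c)}

/-- The orthogonal space `T₁(A)^⊥` with respect to the form `⟨x, y⟩ = ψ(xy)`. -/
def T1perp (ψ : DA F k s c →ₗ[F] F) : Set (DA F k s c) :=
  {y | ∀ x ∈ T1set F k s c, ψ (y * x) = 0}

/-- The first generalized Reynolds ideal, as an ideal of the center `Z(A)`. -/
def ReynoldsIdeal (ψ : DA F k s c →ₗ[F] F) :
    Ideal (Subalgebra.center F (DA F k s c)) :=
  Ideal.span {z : Subalgebra.center F (DA F k s c) | (z : DA F k s c) ∈ T1perp F k s c ψ}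


/-- The set 𝓩, a basis of the center of `A^{k,s}_c`. -/
def ZZ : Set (DA F k s c) :=
  {1, (BGA F k s c) ^ (k - 1) * (Be F k s c * Ga F k s c), (ABG F k s c) ^ k}
    ∪ (fun i => (ABG F k s c) ^ i + (BGA F k s c) ^ i + (GAB F k s c) ^ i) ''
        Set.Icc 1 (k - 1)
    ∪ (fun j => (Et F k s c) ^ j) '' Set.Icc 1 s

section Model

/-- Labels of the path basis: `p0 i, p1 i, p2 i` stand for `(αβγ)^i`, `γ(αβγ)^i`, `βγ(αβγ)^i`
starting from `e₁`; `q1 i, q2 i, q3 i` for `α(βγα)^i`, `γα(βγα)^i`, `(βγα)^(i+1)`;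
`w` for `(αβγ)^k`; `r0 i, r1 i, r2 i` for `(γαβ)^i`, `β(γαβ)^i`, `αβ(γαβ)^i` starting from `e₂`;
and `h j` for `η^(j+1)`. Labels with a too large exponent are not used. -/
inductive Idx : Type
  | p0 (i : ℕ) | p1 (i : ℕ) | p2 (i : ℕ)
  | q1 (i : ℕ) | q2 (i : ℕ) | q3 (i : ℕ)
  | w
  | r0 (i : ℕ) | r1 (i : ℕ) | r2 (i : ℕ)
  | h (j : ℕ)

open Idx

/-- The vector of a basis label. -/
abbrev dl (u : Idx) : Idx →₀ F := Finsupp.single u 1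

variable (K S : ℕ)

/-! The vectors of the paths in the algebra with parameters `k = K + 1`, `s = S + 1`, where the
exponent is arbitrary. -/

def P0 (n : ℕ) : Idx →₀ F := if n ≤ K then dl F (p0 n) else if n = K + 1 then dl F w else 0
def P1 (n : ℕ) : Idx →₀ F := if n ≤ K then dl F (p1 n) else 0
def P2 (n : ℕ) : Idx →₀ F := if n ≤ K then dl F (p2 n) else 0
def Q1 (n : ℕ) : Idx →₀ F := if n ≤ K then dl F (q1 n) else 0
def Q2 (n : ℕ) : Idx →₀ F := if n ≤ K then dl F (q2 n) else 0
def Q3 (n : ℕ) : Idx →₀ F := if n < K then dl F (q3 n) else if n = K then dl F w else 0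
def R0 (n : ℕ) : Idx →₀ F := if n ≤ K then dl F (r0 n) else if n = K + 1 then dl F (h S) else 0
def R1 (n : ℕ) : Idx →₀ F := if n ≤ K then dl F (r1 n) else 0
def R2 (n : ℕ) : Idx →₀ F := if n ≤ K then dl F (r2 n) else 0
def H (n : ℕ) : Idx →₀ F := if n ≤ S then dl F (h n) else 0

/-- Left multiplication by a generator on basis labels. -/
def leftVec (c : F) : Gen → Idx → (Idx →₀ F)
  | .e1, p0 i => dl F (p0 i)
  | .e1, p2 i => dl F (p2 i)
  | .e1, q1 i => dl F (q1 i)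
  | .e1, q3 i => dl F (q3 i)
  | .e1, w => dl F w
  | .e1, r1 i => dl F (r1 i)
  | .e1, r2 i => dl F (r2 i)
  | .e2, p1 i => dl F (p1 i)
  | .e2, q2 i => dl F (q2 i)
  | .e2, r0 i => dl F (r0 i)
  | .e2, h i => dl F (h i)
  | .a, p0 0 => Q1 F K 0
  | .a, p2 i => P0 F K (i + 1)
  | .a, q1 0 => c • dl F w
  | .a, q3 i => Q1 F K (i + 1)
  | .a, r1 i => R2 F K i
  | .b, p1 i => P2 F K i
  | .b, q2 i => Q3 F K i
  | .b, r0 i => R1 F K i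
  | .g, p0 i => P1 F K i
  | .g, q1 i => Q2 F K i
  | .g, r2 i => R0 F K S (i + 1)
  | .h, r0 0 => H F S 0
  | .h, h j => H F S (j + 1)
  | _, _ => 0

/-- Right multiplication by a generator on basis labels. -/
def rightVec (c : F) : Gen → Idx → (Idx →₀ F)
  | .e1, p0 i => dl F (p0 i)
  | .e1, p1 i => dl F (p1 i)
  | .e1, p2 i => dl F (p2 i)
  | .e1, q1 i => dl F (q1 i)
  | .e1, q2 i => dl F (q2 i)
  | .e1, q3 i => dl F (q3 i)
  | .e1, w => dl F w
  | .e2, r0 i => dl F (r0 i)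
  | .e2, r1 i => dl F (r1 i)
  | .e2, r2 i => dl F (r2 i)
  | .e2, h i => dl F (h i)
  | .a, p0 i => Q1 F K i
  | .a, p1 i => Q2 F K i
  | .a, p2 i => Q3 F K i
  | .a, q1 0 => c • dl F w
  | .b, p0 0 => R1 F K 0
  | .b, q1 i => R2 F K i
  | .b, q2 i => R0 F K S (i + 1)
  | .b, q3 i => R1 F K (i + 1)
  | .g, r0 i => P1 F K i
  | .g, r1 i => P2 F K i
  | .g, r2 i => P0 F K (i + 1)
  | .h, r0 0 => H F S 0
  | .h, h j => H F S (j + 1)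
  | _, _ => 0

/-- Left multiplication by a generator. -/
def leftOp (c : F) (t : Gen) : Module.End F (Idx →₀ F) :=
  Finsupp.linearCombination F (leftVec F K S c t)

/-- Right multiplication by a generator. -/
def rightOp (c : F) (t : Gen) : Module.End F (Idx →₀ F) :=
  Finsupp.linearCombination F (rightVec F K S c t)

variable {F}

@[simp] lemma leftOp_single (t : Gen) (u : Idx) :
    leftOp F K S c t (Finsupp.single u 1) = leftVec F K S c t u := by
  simp [leftOp]

@[simp] lemma rightOp_single (t : Gen) (u : Idx) :
    rightOp F K S c t (Finsupp.single u 1) = rightVec F K S c t u := by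
  simp [rightOp]

lemma end_ext {f g : Module.End F (Idx →₀ F)}
    (hfg : ∀ u, f (Finsupp.single u 1) = g (Finsupp.single u 1)) : f = g := by
  ext u : 2
  simpa using hfg u

/-- The product of the left multiplications by `α`, `β`, `γ`. -/
def opX : Module.End F (Idx →₀ F) := leftOp F K S c .a * leftOp F K S c .b * leftOp F K S c .g
/-- The product of the left multiplications by `β`, `γ`, `α`. -/
def opY : Module.End F (Idx →₀ F) := leftOp F K S c .b * leftOp F K S c .g * leftOp F K S c .a
/-- The product of the left multiplications by `γ`, `α`, `β`. -/
def opZ : Module.End F (Idx →₀ F) := leftOp F K S c .g * leftOp F K S c .a * leftOp F K S c .b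

lemma pow_apply_chain {f : Module.End F (Idx →₀ F)} {v : ℕ → Idx →₀ F}
    (hv : ∀ n, f (v n) = v (n + 1)) (n m : ℕ) : (f ^ n) (v m) = v (m + n) := by
  induction n generalizing m with
  | zero => simp
  | succ n ih => rw [pow_succ, Module.End.mul_apply, hv, ih]; congr 1; omega

theorem leftOp_comm_rightOp (t t' : Gen) :
    leftOp F K S c t * rightOp F K S c t' = rightOp F K S c t' * leftOp F K S c t := by
  refine end_ext fun u => ?_
  rw [Module.End.mul_apply, Module.End.mul_apply, leftOp_single, rightOp_single]
  cases t <;> cases t' <;>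
    rcases u with (_ | i) | i | i | (_ | i) | i | i | _ | (_ | i) | i | i | (_ | i) <;>
    simp only [leftVec, rightVec, map_zero, map_smul, leftOp_single, rightOp_single,
      P0, P1, P2, Q1, Q2, Q3, R0, R1, R2, H, smul_zero] <;>
    (try split_ifs) <;>
    (try simp only [leftVec, rightVec, map_zero, leftOp_single, rightOp_single,
      P0, P1, P2, Q1, Q2, Q3, R0, R1, R2, H]) <;>
    (try split_ifs) <;>
    first | rfl | omega

@[simp] lemma leftOp_a_P2 (n : ℕ) :
    leftOp F K S c .a (P2 F K n) = P0 F K (n + 1) := by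
  simp only [P2]
  split_ifs <;> simp [leftVec, P0, *]
  grind

@[simp] lemma leftOp_a_Q3 (n : ℕ) :
    leftOp F K S c .a (Q3 F K n) = Q1 F K (n + 1) := by
  simp only [Q3]
  split_ifs <;> simp [leftVec, Q1, *]

@[simp] lemma leftOp_a_R1 (n : ℕ) :
    leftOp F K S c .a (R1 F K n) = R2 F K n := by
  simp only [R1]
  split_ifs <;> simp [leftVec, R2, *]

@[simp] lemma leftOp_b_P1 (n : ℕ) :
    leftOp F K S c .b (P1 F K n) = P2 F K n := by
  simp only [P1]
  split_ifs <;> simp [leftVec, P2, *]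

@[simp] lemma leftOp_b_Q2 (n : ℕ) :
    leftOp F K S c .b (Q2 F K n) = Q3 F K n := by
  simp only [Q2]
  split_ifs <;> simp [leftVec, Q3, *]
  grind

@[simp] lemma leftOp_b_R0 (n : ℕ) :
    leftOp F K S c .b (R0 F K S n) = R1 F K n := by
  simp only [R0]
  split_ifs <;> simp [leftVec, R1, *]

@[simp] lemma leftOp_g_P0 (n : ℕ) :
    leftOp F K S c .g (P0 F K n) = P1 F K n := by
  simp only [P0]
  split_ifs <;> simp [leftVec, P1, *]

@[simp] lemma leftOp_g_Q1 (n : ℕ) :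
    leftOp F K S c .g (Q1 F K n) = Q2 F K n := by
  simp only [Q1]
  split_ifs <;> simp [leftVec, Q2, *]

@[simp] lemma leftOp_g_R2 (n : ℕ) :
    leftOp F K S c .g (R2 F K n) = R0 F K S (n + 1) := by
  simp only [R2]
  split_ifs <;> simp [leftVec, R0, *]
  grind

@[simp] lemma leftOp_h_H (n : ℕ) : leftOp F K S c .h (H F S n) = H F S (n + 1) := by
  simp only [H]
  split_ifs <;> simp [leftVec, H] <;> grind

lemma opX_pow_P0 (n m : ℕ) : (opX c K S ^ n) (P0 F K m) = P0 F K (m + n) :=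
  pow_apply_chain (v := P0 F K) (by simp [opX]) n m

lemma opX_pow_Q1 (n m : ℕ) : (opX c K S ^ n) (Q1 F K m) = Q1 F K (m + n) :=
  pow_apply_chain (v := Q1 F K) (by simp [opX]) n m

lemma opX_pow_R2 (n m : ℕ) : (opX c K S ^ n) (R2 F K m) = R2 F K (m + n) :=
  pow_apply_chain (v := R2 F K) (by simp [opX]) n m

lemma opY_pow_P2 (n m : ℕ) : (opY c K S ^ n) (P2 F K m) = P2 F K (m + n) :=
  pow_apply_chain (v := P2 F K) (by simp [opY]) n m

lemma opY_pow_Q3 (n m : ℕ) : (opY c K S ^ n) (Q3 F K m) = Q3 F K (m + n) :=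
  pow_apply_chain (v := Q3 F K) (by simp [opY]) n m

lemma opY_pow_R1 (n m : ℕ) : (opY c K S ^ n) (R1 F K m) = R1 F K (m + n) :=
  pow_apply_chain (v := R1 F K) (by simp [opY]) n m

lemma opZ_pow_P1 (n m : ℕ) : (opZ c K S ^ n) (P1 F K m) = P1 F K (m + n) :=
  pow_apply_chain (v := P1 F K) (by simp [opZ]) n m

lemma opZ_pow_Q2 (n m : ℕ) : (opZ c K S ^ n) (Q2 F K m) = Q2 F K (m + n) :=
  pow_apply_chain (v := Q2 F K) (by simp [opZ]) n m

lemma opZ_pow_R0 (n m : ℕ) : (opZ c K S ^ n) (R0 F K S m) = R0 F K S (m + n) :=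
  pow_apply_chain (v := R0 F K S) (by simp [opZ]) n m

lemma leftOp_h_pow_H (n m : ℕ) : (leftOp F K S c .h ^ n) (H F S m) = H F S (m + n) :=
  pow_apply_chain (v := H F S) (by simp) n m

lemma opX_single (u : Idx) :
    opX c K S (Finsupp.single u 1) = match u with
      | p0 i => P0 F K (i + 1)
      | q1 i => Q1 F K (i + 1)
      | r2 i => R2 F K (i + 1)
      | _ => 0 := by
  rcases u with (_ | i) | i | i | (_ | i) | i | i | _ | (_ | i) | i | i | i <;>
    simp [opX, leftVec, -Finsupp.smul_single]

/-- The action of `(αβγ)^(n+1)` on basis labels. -/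
lemma opX_pow_succ_single (n : ℕ) (u : Idx) :
    (opX c K S ^ (n + 1)) (Finsupp.single u 1) = match u with
      | p0 i => P0 F K (i + 1 + n)
      | q1 i => Q1 F K (i + 1 + n)
      | r2 i => R2 F K (i + 1 + n)
      | _ => 0 := by
  rw [pow_succ, Module.End.mul_apply, opX_single]
  rcases u with (_ | i) | i | i | (_ | i) | i | i | _ | (_ | i) | i | i | i <;>
    simp [opX_pow_P0, opX_pow_Q1, opX_pow_R2]

lemma opY_single (u : Idx) :
    opY c K S (Finsupp.single u 1) = match u with
      | p0 0 => Q3 F K 0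
      | p2 i => P2 F K (i + 1)
      | q3 i => Q3 F K (i + 1)
      | r1 i => R1 F K (i + 1)
      | _ => 0 := by
  rcases u with (_ | i) | i | i | (_ | i) | i | i | _ | (_ | i) | i | i | i <;>
    simp [opY, leftVec, -Finsupp.smul_single]

/-- The action of `(βγα)^(n+1)` on basis labels. -/
lemma opY_pow_succ_single (n : ℕ) (u : Idx) :
    (opY c K S ^ (n + 1)) (Finsupp.single u 1) = match u with
      | p0 0 => Q3 F K n
      | p2 i => P2 F K (i + 1 + n)
      | q3 i => Q3 F K (i + 1 + n)
      | r1 i => R1 F K (i + 1 + n)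
      | _ => 0 := by
  rw [pow_succ, Module.End.mul_apply, opY_single]
  rcases u with (_ | i) | i | i | (_ | i) | i | i | _ | (_ | i) | i | i | i <;>
    simp [opY_pow_P2, opY_pow_Q3, opY_pow_R1]

lemma opZ_single (u : Idx) :
    opZ c K S (Finsupp.single u 1) = match u with
      | p1 i => P1 F K (i + 1)
      | q2 i => Q2 F K (i + 1)
      | r0 i => R0 F K S (i + 1)
      | _ => 0 := by
  rcases u with (_ | i) | i | i | (_ | i) | i | i | _ | (_ | i) | i | i | i <;>
    simp [opZ, leftVec, -Finsupp.smul_single]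

/-- The action of `(γαβ)^(n+1)` on basis labels. -/
lemma opZ_pow_succ_single (n : ℕ) (u : Idx) :
    (opZ c K S ^ (n + 1)) (Finsupp.single u 1) = match u with
      | p1 i => P1 F K (i + 1 + n)
      | q2 i => Q2 F K (i + 1 + n)
      | r0 i => R0 F K S (i + 1 + n)
      | _ => 0 := by
  rw [pow_succ, Module.End.mul_apply, opZ_single]
  rcases u with (_ | i) | i | i | (_ | i) | i | i | _ | (_ | i) | i | i | i <;>
    simp [opZ_pow_P1, opZ_pow_Q2, opZ_pow_R0]

/-- The action of `η^(n+1)` on basis labels. -/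
lemma leftOp_h_pow_succ_single (n : ℕ) (u : Idx) :
    (leftOp F K S c .h ^ (n + 1)) (Finsupp.single u 1) = match u with
      | r0 0 => H F S n
      | h j => H F S (j + 1 + n)
      | _ => 0 := by
  rw [pow_succ, Module.End.mul_apply]
  rcases u with (_ | i) | i | i | (_ | i) | i | i | _ | (_ | i) | i | i | i <;>
    simp [leftVec, leftOp_h_pow_H]

lemma lift_leftOp_eq_of_rel {x y : FreeAlgebra F Gen} (hxy : Rel F (K + 1) (S + 1) c x y) :
    FreeAlgebra.lift F (leftOp F K S c) x = FreeAlgebra.lift F (leftOp F K S c) y := by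
  refine end_ext fun u => ?_
  cases hxy
  case abg =>
    simp only [gen, map_mul, map_pow, FreeAlgebra.lift_ι_apply]
    rw [← opX, ← opY, opX_pow_succ_single, opY_pow_succ_single]
    rcases u with (_ | i) | i | i | (_ | i) | i | i | _ | (_ | i) | i | i | i <;>
      simp [P0, P2, Q1, Q3, R1, R2] <;> grind
  case hs =>
    simp only [gen, map_mul, map_pow, FreeAlgebra.lift_ι_apply]
    rw [← opZ, opZ_pow_succ_single, leftOp_h_pow_succ_single]
    rcases u with (_ | i) | i | i | (_ | i) | i | i | _ | (_ | i) | i | i | i <;>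
      simp [P1, Q2, R0, H] <;> grind
  case asq =>
    simp only [gen, map_mul, map_pow, map_smul, FreeAlgebra.lift_ι_apply]
    rw [← opX, LinearMap.smul_apply, opX_pow_succ_single, Module.End.mul_apply]
    rcases u with (_ | i) | i | i | (_ | i) | i | i | _ | (_ | i) | i | i | i <;>
      simp [leftVec, P0, Q1, R2, -Finsupp.smul_single] <;> grind [leftVec, leftOp_single]
  all_goals
    simp only [gen, map_mul, map_add, map_one, map_zero, FreeAlgebra.lift_ι_apply,
      Module.End.mul_apply, LinearMap.add_apply, Module.End.one_apply, leftOp_single]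
    rcases u with (_ | i) | i | i | (_ | i) | i | i | _ | (_ | i) | i | i | i <;>
      simp only [leftVec, map_zero, map_smul, leftOp_single, P0, P1, P2, Q1, Q2, Q3, R0, R1, R2, H,
        LinearMap.zero_apply, add_zero, zero_add] <;>
      (try split_ifs) <;>
      simp [leftVec, H]

/-! ### Relations in the algebra -/

local notation "e₁" => E1 F (K + 1) (S + 1) c
local notation "e₂" => E2 F (K + 1) (S + 1) c
local notation "α" => Al F (K + 1) (S + 1) c
local notation "β" => Be F (K + 1) (S + 1) c
local notation "γ" => Ga F (K + 1) (S + 1) c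
local notation "η" => Et F (K + 1) (S + 1) c
local notation "αβγ" => ABG F (K + 1) (S + 1) c
local notation "βγα" => BGA F (K + 1) (S + 1) c
local notation "γαβ" => GAB F (K + 1) (S + 1) c

lemma mk_eq_of_rel {k s : ℕ} {x y : FreeAlgebra F Gen} (hxy : Rel F k s c x y) :
    mk F k s c x = mk F k s c y :=
  RingQuot.mkAlgHom_rel F hxy

lemma e1_add_e2 : e₁ + e₂ = 1 := by
  simpa [E1, E2] using mk_eq_of_rel c (Rel.unit (F := F) (k := K + 1) (s := S + 1))

lemma e1_mul_e1 : e₁ * e₁ = e₁ := by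
  simpa [E1] using mk_eq_of_rel c (Rel.idem1 (F := F) (k := K + 1) (s := S + 1))

lemma e2_mul_e2 : e₂ * e₂ = e₂ := by
  simpa [E2] using mk_eq_of_rel c (Rel.idem2 (F := F) (k := K + 1) (s := S + 1))

lemma e1_mul_e2 : e₁ * e₂ = 0 := by
  simpa [E1, E2] using mk_eq_of_rel c (Rel.orth12 (F := F) (k := K + 1) (s := S + 1))

lemma e2_mul_e1 : e₂ * e₁ = 0 := by
  simpa [E1, E2] using mk_eq_of_rel c (Rel.orth21 (F := F) (k := K + 1) (s := S + 1))

lemma e1_mul_al : e₁ * α = α := by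
  simpa [E1, Al] using mk_eq_of_rel c (Rel.aL (F := F) (k := K + 1) (s := S + 1))

lemma al_mul_e1 : α * e₁ = α := by
  simpa [E1, Al] using mk_eq_of_rel c (Rel.aR (F := F) (k := K + 1) (s := S + 1))

lemma e1_mul_be : e₁ * β = β := by
  simpa [E1, Be] using mk_eq_of_rel c (Rel.bL (F := F) (k := K + 1) (s := S + 1))

lemma be_mul_e2 : β * e₂ = β := by
  simpa [E2, Be] using mk_eq_of_rel c (Rel.bR (F := F) (k := K + 1) (s := S + 1))

lemma e2_mul_ga : e₂ * γ = γ := by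
  simpa [E2, Ga] using mk_eq_of_rel c (Rel.gL (F := F) (k := K + 1) (s := S + 1))

lemma ga_mul_e1 : γ * e₁ = γ := by
  simpa [E1, Ga] using mk_eq_of_rel c (Rel.gR (F := F) (k := K + 1) (s := S + 1))

lemma e2_mul_et : e₂ * η = η := by
  simpa [E2, Et] using mk_eq_of_rel c (Rel.hL (F := F) (k := K + 1) (s := S + 1))

lemma et_mul_e2 : η * e₂ = η := by
  simpa [E2, Et] using mk_eq_of_rel c (Rel.hR (F := F) (k := K + 1) (s := S + 1))

lemma be_mul_et : β * η = 0 := by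
  simpa [Be, Et] using mk_eq_of_rel c (Rel.bh (F := F) (k := K + 1) (s := S + 1))

lemma et_mul_ga : η * γ = 0 := by
  simpa [Ga, Et] using mk_eq_of_rel c (Rel.hg (F := F) (k := K + 1) (s := S + 1))

lemma ga_mul_be : γ * β = 0 := by
  simpa [Be, Ga] using mk_eq_of_rel c (Rel.gb (F := F) (k := K + 1) (s := S + 1))

lemma al_mul_al : α * α = c • αβγ ^ (K + 1) := by
  simpa [Al, ABG, Be, Ga] using mk_eq_of_rel c (Rel.asq (F := F) (k := K + 1) (s := S + 1))

lemma abg_pow_eq_bga_pow : αβγ ^ (K + 1) = βγα ^ (K + 1) := by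
  simpa [Al, ABG, BGA, Be, Ga] using mk_eq_of_rel c (Rel.abg (F := F) (k := K + 1) (s := S + 1))

lemma et_pow_eq_gab_pow : η ^ (S + 1) = γαβ ^ (K + 1) := by
  simpa [Al, GAB, Be, Ga, Et] using mk_eq_of_rel c (Rel.hs (F := F) (k := K + 1) (s := S + 1))

lemma mul_eq_zero_of_orthogonal {A : Type} [Ring A] {x y e e' : A} (hx : x * e = x)
    (hy : e' * y = y) (he : e * e' = 0) : x * y = 0 := by
  rw [← hx, ← hy, mul_assoc, ← mul_assoc e, he, zero_mul, mul_zero]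

lemma mul_mul_eq_zero {A : Type} [Ring A] {x y : A} (hxy : x * y = 0) (z : A) :
    x * (y * z) = 0 := by
  rw [← mul_assoc, hxy, zero_mul]

lemma mul_mul_eq {A : Type} [Ring A] {x y w : A} (hxy : x * y = w) (z : A) :
    x * (y * z) = w * z := by
  rw [← mul_assoc, hxy]

lemma al_mul_ga : α * γ = 0 :=
  mul_eq_zero_of_orthogonal (al_mul_e1 c K S) (e2_mul_ga c K S) (e1_mul_e2 c K S)

lemma al_mul_et : α * η = 0 :=
  mul_eq_zero_of_orthogonal (al_mul_e1 c K S) (e2_mul_et c K S) (e1_mul_e2 c K S)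

lemma al_mul_e2 : α * e₂ = 0 :=
  mul_eq_zero_of_orthogonal (al_mul_e1 c K S) (e2_mul_e2 c K S) (e1_mul_e2 c K S)

lemma e1_mul_ga : e₁ * γ = 0 :=
  mul_eq_zero_of_orthogonal (e1_mul_e1 c K S) (e2_mul_ga c K S) (e1_mul_e2 c K S)

lemma e1_mul_et : e₁ * η = 0 :=
  mul_eq_zero_of_orthogonal (e1_mul_e1 c K S) (e2_mul_et c K S) (e1_mul_e2 c K S)

lemma ga_mul_ga : γ * γ = 0 :=
  mul_eq_zero_of_orthogonal (ga_mul_e1 c K S) (e2_mul_ga c K S) (e1_mul_e2 c K S)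

lemma ga_mul_et : γ * η = 0 :=
  mul_eq_zero_of_orthogonal (ga_mul_e1 c K S) (e2_mul_et c K S) (e1_mul_e2 c K S)

lemma ga_mul_e2 : γ * e₂ = 0 :=
  mul_eq_zero_of_orthogonal (ga_mul_e1 c K S) (e2_mul_e2 c K S) (e1_mul_e2 c K S)

lemma e2_mul_al : e₂ * α = 0 :=
  mul_eq_zero_of_orthogonal (e2_mul_e2 c K S) (e1_mul_al c K S) (e2_mul_e1 c K S)

lemma e2_mul_be : e₂ * β = 0 :=
  mul_eq_zero_of_orthogonal (e2_mul_e2 c K S) (e1_mul_be c K S) (e2_mul_e1 c K S)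

lemma be_mul_al : β * α = 0 :=
  mul_eq_zero_of_orthogonal (be_mul_e2 c K S) (e1_mul_al c K S) (e2_mul_e1 c K S)

lemma be_mul_be : β * β = 0 :=
  mul_eq_zero_of_orthogonal (be_mul_e2 c K S) (e1_mul_be c K S) (e2_mul_e1 c K S)

lemma be_mul_e1 : β * e₁ = 0 :=
  mul_eq_zero_of_orthogonal (be_mul_e2 c K S) (e1_mul_e1 c K S) (e2_mul_e1 c K S)

lemma et_mul_al : η * α = 0 :=
  mul_eq_zero_of_orthogonal (et_mul_e2 c K S) (e1_mul_al c K S) (e2_mul_e1 c K S)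

lemma et_mul_be : η * β = 0 :=
  mul_eq_zero_of_orthogonal (et_mul_e2 c K S) (e1_mul_be c K S) (e2_mul_e1 c K S)

lemma et_mul_e1 : η * e₁ = 0 :=
  mul_eq_zero_of_orthogonal (et_mul_e2 c K S) (e1_mul_e1 c K S) (e2_mul_e1 c K S)

lemma abg_pow_succ (n : ℕ) : αβγ ^ (n + 1) = α * (β * (γ * αβγ ^ n)) := by
  rw [pow_succ', ABG, mul_assoc, mul_assoc]

lemma bga_pow_succ (n : ℕ) : βγα ^ (n + 1) = β * (γ * (α * βγα ^ n)) := by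
  rw [pow_succ', BGA, mul_assoc, mul_assoc]

lemma gab_pow_succ (n : ℕ) : γαβ ^ (n + 1) = γ * (α * (β * γαβ ^ n)) := by
  rw [pow_succ', GAB, mul_assoc, mul_assoc]

lemma al_mul_al_mul_be (x : DA F (K + 1) (S + 1) c) : α * (α * (β * x)) = 0 := by
  rw [mul_mul_eq (al_mul_al c K S), smul_mul_assoc, pow_succ, ABG]
  simp only [mul_assoc, mul_mul_eq_zero (ga_mul_be c K S), mul_zero, smul_zero]

lemma ga_mul_abg_pow : γ * αβγ ^ (K + 1) = 0 := by
  rw [abg_pow_eq_bga_pow, bga_pow_succ, mul_mul_eq_zero (ga_mul_be c K S)]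

lemma et_pow_eq_zero : η ^ (S + 2) = 0 := by
  rw [pow_succ', et_pow_eq_gab_pow, gab_pow_succ, mul_mul_eq_zero (et_mul_ga c K S)]

/-- The path of a basis label, and `0` if the exponent is too large. -/
def path : Idx → DA F (K + 1) (S + 1) c
  | p0 0 => e₁
  | p0 (i + 1) => if i + 1 ≤ K then αβγ ^ (i + 1) else 0
  | p1 i => if i ≤ K then γ * αβγ ^ i else 0
  | p2 i => if i ≤ K then β * (γ * αβγ ^ i) else 0
  | q1 i => if i ≤ K then α * βγα ^ i else 0
  | q2 i => if i ≤ K then γ * (α * βγα ^ i) else 0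
  | q3 i => if i < K then βγα ^ (i + 1) else 0
  | w => αβγ ^ (K + 1)
  | r0 0 => e₂
  | r0 (i + 1) => if i + 1 ≤ K then γαβ ^ (i + 1) else 0
  | r1 i => if i ≤ K then β * γαβ ^ i else 0
  | r2 i => if i ≤ K then α * (β * γαβ ^ i) else 0
  | h j => if j ≤ S then η ^ (j + 1) else 0

/-- The linear map sending a basis label to its path. -/
def toAlg : (Idx →₀ F) →ₗ[F] DA F (K + 1) (S + 1) c := Finsupp.linearCombination F (path c K S)

@[simp] lemma toAlg_single (u : Idx) : toAlg c K S (Finsupp.single u 1) = path c K S u := by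
  simp [toAlg]

lemma toAlg_leftOp (t : Gen) (v : Idx →₀ F) :
    toAlg c K S (leftOp F K S c t v) = mk F (K + 1) (S + 1) c (gen F t) * toAlg c K S v := by
  suffices hs : toAlg c K S ∘ₗ leftOp F K S c t =
      LinearMap.mulLeft F (mk F (K + 1) (S + 1) c (gen F t)) ∘ₗ toAlg c K S from
    LinearMap.congr_fun hs v
  ext u : 2
  simp only [LinearMap.comp_apply, Finsupp.lsingle_apply, leftOp_single, LinearMap.mulLeft_apply,
    toAlg_single]
  cases t
  case e1 =>
    change _ = e₁ * _
    rcases u with (_ | i) | i | i | (_ | i) | i | i | _ | (_ | i) | i | i | (_ | i) <;>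
      simp [leftVec, path, abg_pow_succ, bga_pow_succ, gab_pow_succ, pow_succ' η, e1_mul_e1,
        e1_mul_e2, mul_mul_eq (e1_mul_al c K S), mul_mul_eq (e1_mul_be c K S),
        mul_mul_eq_zero (e1_mul_ga c K S), mul_mul_eq_zero (e1_mul_et c K S), e1_mul_et, e1_mul_al]
  case e2 =>
    change _ = e₂ * _
    rcases u with (_ | i) | i | i | (_ | i) | i | i | _ | (_ | i) | i | i | (_ | i) <;>
      simp [leftVec, path, abg_pow_succ, bga_pow_succ, gab_pow_succ, pow_succ' η, e2_mul_e1,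
        e2_mul_e2, mul_mul_eq_zero (e2_mul_al c K S), mul_mul_eq_zero (e2_mul_be c K S),
        mul_mul_eq (e2_mul_ga c K S), mul_mul_eq (e2_mul_et c K S), e2_mul_et, e2_mul_al]
  case a =>
    change _ = α * _
    rcases u with (_ | i) | i | i | (_ | i) | i | i | _ | (_ | i) | i | i | (_ | i) <;>
      simp [leftVec, path, abg_pow_succ, bga_pow_succ, gab_pow_succ, pow_succ' η, al_mul_e1,
        al_mul_e2, mul_mul_eq_zero (al_mul_ga c K S), mul_mul_eq_zero (al_mul_et c K S),
        al_mul_al_mul_be, al_mul_al, al_mul_et, P0, Q1, R2, apply_ite (toAlg c K S),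
        -Finsupp.smul_single] <;> grind
  case b =>
    change _ = β * _
    have hw := abg_pow_eq_bga_pow c K S
    rw [abg_pow_succ, bga_pow_succ] at hw
    rcases u with (_ | i) | i | i | (_ | i) | i | i | _ | (_ | i) | i | i | (_ | i) <;>
      simp [leftVec, path, abg_pow_succ, bga_pow_succ, gab_pow_succ, pow_succ' η, be_mul_e1,
        be_mul_e2, mul_mul_eq_zero (be_mul_al c K S), mul_mul_eq_zero (be_mul_et c K S),
        mul_mul_eq_zero (be_mul_be c K S), be_mul_et, be_mul_al, P2, Q3, R1,
        apply_ite (toAlg c K S)] <;> grind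
  case g =>
    change _ = γ * _
    have hw := ga_mul_abg_pow c K S
    rw [abg_pow_succ] at hw
    have hv := et_pow_eq_gab_pow c K S
    rw [pow_succ', gab_pow_succ] at hv
    rcases u with (_ | i) | i | i | (_ | i) | i | i | _ | (_ | i) | i | i | (_ | i) <;>
      simp [leftVec, path, abg_pow_succ, bga_pow_succ, gab_pow_succ, pow_succ' η, ga_mul_e1,
        ga_mul_e2, mul_mul_eq_zero (ga_mul_ga c K S), mul_mul_eq_zero (ga_mul_et c K S),
        mul_mul_eq_zero (ga_mul_be c K S), ga_mul_et, P1, Q2, R0,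
        apply_ite (toAlg c K S)] <;> grind
  case h =>
    change _ = η * _
    have hv := et_pow_eq_zero c K S
    rcases u with (_ | i) | i | i | (_ | i) | i | i | _ | (_ | i) | i | i | j <;>
      simp [leftVec, path, abg_pow_succ, bga_pow_succ, gab_pow_succ, ← pow_succ' η, et_mul_e1,
        et_mul_e2, mul_mul_eq_zero (et_mul_ga c K S), mul_mul_eq_zero (et_mul_al c K S),
        mul_mul_eq_zero (et_mul_be c K S), et_mul_al, H,
        apply_ite (toAlg c K S)]
    grind

/-! ### The regular representation -/

/-- The left regular representation on the span of the basis labels. -/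
def leftRep : DA F (K + 1) (S + 1) c →ₐ[F] Module.End F (Idx →₀ F) :=
  RingQuot.liftAlgHom F
    ⟨FreeAlgebra.lift F (leftOp F K S c), fun _ _ hxy => lift_leftOp_eq_of_rel c K S hxy⟩

@[simp] lemma leftRep_mk_gen (t : Gen) :
    leftRep c K S (mk F (K + 1) (S + 1) c (gen F t)) = leftOp F K S c t := by
  refine (RingQuot.liftAlgHom_mkAlgHom_apply F _ _ _).trans ?_
  simp [gen]

lemma da_induction {k s : ℕ} {P : DA F k s c → Prop}
    (hscalar : ∀ r, P (algebraMap F _ r)) (hgen : ∀ t, P (mk F k s c (gen F t)))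
    (hadd : ∀ x y, P x → P y → P (x + y)) (hmul : ∀ x y, P x → P y → P (x * y))
    (x : DA F k s c) : P x := by
  obtain ⟨x, rfl⟩ := RingQuot.mkAlgHom_surjective F (Rel F k s c) x
  change P (mk F k s c x)
  induction x using FreeAlgebra.induction with
  | grade0 r => rw [AlgHom.commutes]; exact hscalar r
  | grade1 t => exact hgen t
  | add x y hx hy => rw [map_add]; exact hadd _ _ hx hy
  | mul x y hx hy => rw [map_mul]; exact hmul _ _ hx hy

lemma toAlg_leftRep (x : DA F (K + 1) (S + 1) c) (v : Idx →₀ F) :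
    toAlg c K S (leftRep c K S x v) = x * toAlg c K S v := by
  induction x using da_induction generalizing v with
  | hscalar r => simp [Module.algebraMap_end_apply, Algebra.smul_def]
  | hgen t => rw [leftRep_mk_gen, toAlg_leftOp]
  | hadd x y hx hy => rw [map_add, LinearMap.add_apply, map_add, hx, hy, add_mul]
  | hmul x y hx hy => rw [map_mul, Module.End.mul_apply, hx, hy, mul_assoc]

lemma leftRep_rightOp (x : DA F (K + 1) (S + 1) c) (t : Gen) (v : Idx →₀ F) :
    leftRep c K S x (rightOp F K S c t v) = rightOp F K S c t (leftRep c K S x v) := by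
  induction x using da_induction generalizing v with
  | hscalar r => simp [Module.algebraMap_end_apply]
  | hgen t' =>
    simpa using LinearMap.congr_fun (leftOp_comm_rightOp c K S t' t) v
  | hadd x y hx hy => simp [hx, hy]
  | hmul x y hx hy => simp [hx, hy]

/-- The coordinates of an element of the algebra in the path basis. -/
def coords : DA F (K + 1) (S + 1) c →ₗ[F] Idx →₀ F :=
  LinearMap.applyₗ (dl F (p0 0) + dl F (r0 0)) ∘ₗ (leftRep c K S).toLinearMap

lemma coords_apply (x : DA F (K + 1) (S + 1) c) :
    coords c K S x = leftRep c K S x (dl F (p0 0) + dl F (r0 0)) := rfl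

lemma toAlg_coords (x : DA F (K + 1) (S + 1) c) : toAlg c K S (coords c K S x) = x := by
  simp [coords_apply, toAlg_leftRep, path, e1_add_e2, ← mul_add]

lemma coords_injective : Function.Injective (coords c K S) :=
  Function.LeftInverse.injective (toAlg_coords c K S)

lemma coords_gen_mul (t : Gen) (x : DA F (K + 1) (S + 1) c) :
    coords c K S (mk F (K + 1) (S + 1) c (gen F t) * x) =
      leftOp F K S c t (coords c K S x) := by
  simp [coords_apply]

lemma coords_mul_gen (t : Gen) (x : DA F (K + 1) (S + 1) c) :
    coords c K S (x * mk F (K + 1) (S + 1) c (gen F t)) =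
      rightOp F K S c t (coords c K S x) := by
  rw [coords_apply, coords_apply, ← leftRep_rightOp, map_mul, Module.End.mul_apply,
    leftRep_mk_gen]
  congr 1
  cases t <;> simp [leftVec, rightVec]

lemma mem_center_iff {x : DA F (K + 1) (S + 1) c} :
    x ∈ Subalgebra.center F (DA F (K + 1) (S + 1) c) ↔
      ∀ t, leftOp F K S c t (coords c K S x) = rightOp F K S c t (coords c K S x) := by
  rw [Subalgebra.mem_center_iff]
  refine ⟨fun hx t => ?_, fun hx y => ?_⟩
  · rw [← coords_gen_mul, hx, coords_mul_gen]
  · induction y using da_induction with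
    | hscalar r => exact Algebra.commutes r x
    | hgen t => exact coords_injective c K S (by rw [coords_gen_mul, hx, coords_mul_gen])
    | hadd y z hy hz => rw [add_mul, mul_add, hy, hz]
    | hmul y z hy hz => rw [mul_assoc, hz, ← mul_assoc, hy, mul_assoc]

/-! ### The basis of the center -/

/-- The set `𝓩` as an indexed family. -/
def centerFamily : Fin 3 ⊕ Fin K ⊕ Fin (S + 1) → DA F (K + 1) (S + 1) c
  | .inl 0 => 1
  | .inl 1 => βγα ^ K * (β * γ)
  | .inl 2 => αβγ ^ (K + 1)
  | .inr (.inl i) => αβγ ^ (i.1 + 1) + βγα ^ (i.1 + 1) + γαβ ^ (i.1 + 1)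
  | .inr (.inr j) => η ^ (j.1 + 1)

/-- The coordinates of the family `centerFamily`. -/
def centerVec : Fin 3 ⊕ Fin K ⊕ Fin (S + 1) → Idx →₀ F
  | .inl 0 => dl F (p0 0) + dl F (r0 0)
  | .inl 1 => dl F (p2 K)
  | .inl 2 => dl F w
  | .inr (.inl i) => dl F (p0 (i.1 + 1)) + dl F (q3 i.1) + dl F (r0 (i.1 + 1))
  | .inr (.inr j) => dl F (h j.1)

/-- A label at which only one member of `centerFamily` has a nonzero coordinate. -/
def centerLabel : Fin 3 ⊕ Fin K ⊕ Fin (S + 1) → Idx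
  | .inl 0 => p0 0
  | .inl 1 => p2 K
  | .inl 2 => w
  | .inr (.inl i) => p0 (i.1 + 1)
  | .inr (.inr j) => h j.1

lemma leftRep_abg : leftRep c K S αβγ = opX c K S := by
  simp [ABG, Al, Be, Ga, opX]

lemma leftRep_bga : leftRep c K S βγα = opY c K S := by
  simp [BGA, Al, Be, Ga, opY]

lemma leftRep_gab : leftRep c K S γαβ = opZ c K S := by
  simp [GAB, Al, Be, Ga, opZ]

lemma leftRep_et : leftRep c K S η = leftOp F K S c .h := by
  simp [Et]

lemma coords_centerFamily (j : Fin 3 ⊕ Fin K ⊕ Fin (S + 1)) :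
    coords c K S (centerFamily c K S j) = centerVec K S j := by
  rw [coords_apply]
  rcases j with j | i | j
  · fin_cases j
    · simp [centerFamily, centerVec]
    · have h1 : leftOp F K S c .b (leftOp F K S c .g (dl F (p0 0) + dl F (r0 0))) = P2 F K 0 := by
        rw [map_add, leftOp_single, leftOp_single]
        simp [leftVec]
      simp only [centerFamily, centerVec, map_mul, map_pow, leftRep_bga, Be, Ga, leftRep_mk_gen,
        Module.End.mul_apply]
      rw [h1, opY_pow_P2]
      simp [P2]
    · simp [centerFamily, centerVec, leftRep_abg, opX_pow_succ_single, P0, add_comm 1]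
  · simp [centerFamily, centerVec, leftRep_abg, leftRep_bga, leftRep_gab, opX_pow_succ_single,
      opY_pow_succ_single, opZ_pow_succ_single, P0, Q3, R0, add_comm 1]
  · simp [centerFamily, centerVec, leftRep_et, leftOp_h_pow_succ_single, H, Fin.is_le]

open Classical in
lemma centerVec_centerLabel (i j : Fin 3 ⊕ Fin K ⊕ Fin (S + 1)) :
    centerVec (F := F) K S j (centerLabel K S i) = if i = j then 1 else 0 := by
  rcases i with i | i | i <;> rcases j with j | j | j <;> (try fin_cases i) <;>
    (try fin_cases j) <;> simp [centerLabel, centerVec, Finsupp.single_apply, Fin.ext_iff, eq_comm]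

lemma linearIndependent_centerFamily : LinearIndependent F (centerFamily c K S) := by
  refine LinearIndependent.of_comp (coords c K S) ?_
  have hv : coords c K S ∘ centerFamily c K S = centerVec K S :=
    funext (coords_centerFamily c K S)
  rw [hv]
  refine LinearIndependent.of_pairwise_dual_eq_zero_one _
    (fun j => Finsupp.lapply (centerLabel K S j)) (fun i j hij => ?_) fun i => ?_
  · simp [centerVec_centerLabel, hij]
  · simp [centerVec_centerLabel]

lemma centerFamily_mem_center (j : Fin 3 ⊕ Fin K ⊕ Fin (S + 1)) :
    centerFamily c K S j ∈ Subalgebra.center F (DA F (K + 1) (S + 1) c) := by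
  rw [mem_center_iff]
  intro t
  rw [coords_centerFamily]
  rcases j with j | ⟨i, hi⟩ | j
  · fin_cases j <;> cases t <;> simp [centerVec, leftVec, rightVec, P0, Q3]
  · cases t <;> simp [centerVec, leftVec, rightVec, Q1, R1, P1]
  · cases t <;> simp [centerVec, leftVec, rightVec]

lemma range_centerFamily : Set.range (centerFamily c K S) = ZZ F (K + 1) (S + 1) c := by
  ext x
  simp only [Set.mem_range, Sum.exists, ZZ, Set.mem_union, Set.mem_image,
    Set.mem_insert_iff, Set.mem_singleton_iff, Set.mem_Icc, Nat.add_sub_cancel]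
  constructor
  · rintro (⟨j, rfl⟩ | ⟨i, rfl⟩ | ⟨j, rfl⟩)
    · fin_cases j <;> simp [centerFamily]
    · exact .inl (.inr ⟨i + 1, ⟨by omega, by omega⟩, rfl⟩)
    · exact .inr ⟨j + 1, ⟨by omega, by omega⟩, rfl⟩
  · rintro (((rfl | rfl | rfl) | ⟨i, ⟨hi, hi'⟩, rfl⟩) | ⟨j, ⟨hj, hj'⟩, rfl⟩)
    · exact .inl ⟨0, rfl⟩
    · exact .inl ⟨1, rfl⟩
    · exact .inl ⟨2, rfl⟩
    · obtain ⟨i, rfl⟩ := Nat.exists_eq_add_of_le' hi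
      exact .inr (.inl ⟨⟨i, by omega⟩, rfl⟩)
    · obtain ⟨j, rfl⟩ := Nat.exists_eq_add_of_le' hj
      exact .inr (.inr ⟨⟨j, by omega⟩, rfl⟩)

lemma linearCombination_apply_eq {f : Idx → Idx →₀ F} {i j : Idx}
    (hf : ∀ u, f u i = Finsupp.single u 1 j) (v : Idx →₀ F) :
    Finsupp.linearCombination F f v i = v j := by
  have : Finsupp.lapply i ∘ₗ Finsupp.linearCombination F f = Finsupp.lapply (R := F) j := by
    ext u
    simpa using hf u
  exact LinearMap.congr_fun this v

lemma linearCombination_apply_eq_zero {f : Idx → Idx →₀ F} {i : Idx}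
    (hf : ∀ u, f u i = 0) (v : Idx →₀ F) : Finsupp.linearCombination F f v i = 0 := by
  have : Finsupp.lapply i ∘ₗ Finsupp.linearCombination F f = 0 := by
    ext u
    simpa using hf u
  exact LinearMap.congr_fun this v

lemma toAlg_eq_zero {v : Idx →₀ F} (hv : ∀ u, v u = 0 ∨ path c K S u = 0) :
    toAlg c K S v = 0 := by
  rw [toAlg, Finsupp.linearCombination_apply]
  exact Finset.sum_eq_zero fun u _ => smul_eq_zero.2 (hv u)

lemma leftOp_e1_apply_p1 {i : ℕ} (v : Idx →₀ F) :
    leftOp F K S c .e1 v (p1 i) = 0 := by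
  classical
  refine linearCombination_apply_eq_zero (fun u => ?_) v
  rcases u with (_ | u) | u | u | (_ | u) | u | u | _ | (_ | u) | u | u | u <;>
    simp [leftVec]

lemma rightOp_e1_apply_p1 {i : ℕ} (v : Idx →₀ F) :
    rightOp F K S c .e1 v (p1 i) = v (p1 i) := by
  classical
  refine linearCombination_apply_eq (fun u => ?_) v
  rcases u with (_ | u) | u | u | (_ | u) | u | u | _ | (_ | u) | u | u | u <;>
    simp [rightVec, Finsupp.single_apply]

lemma leftOp_e1_apply_q2 {i : ℕ} (v : Idx →₀ F) :
    leftOp F K S c .e1 v (q2 i) = 0 := by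
  classical
  refine linearCombination_apply_eq_zero (fun u => ?_) v
  rcases u with (_ | u) | u | u | (_ | u) | u | u | _ | (_ | u) | u | u | u <;>
    simp [leftVec]

lemma rightOp_e1_apply_q2 {i : ℕ} (v : Idx →₀ F) :
    rightOp F K S c .e1 v (q2 i) = v (q2 i) := by
  classical
  refine linearCombination_apply_eq (fun u => ?_) v
  rcases u with (_ | u) | u | u | (_ | u) | u | u | _ | (_ | u) | u | u | u <;>
    simp [rightVec, Finsupp.single_apply]

lemma leftOp_e1_apply_r1 {i : ℕ} (v : Idx →₀ F) :
    leftOp F K S c .e1 v (r1 i) = v (r1 i) := by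
  classical
  refine linearCombination_apply_eq (fun u => ?_) v
  rcases u with (_ | u) | u | u | (_ | u) | u | u | _ | (_ | u) | u | u | u <;>
    simp [leftVec, Finsupp.single_apply]

lemma rightOp_e1_apply_r1 {i : ℕ} (v : Idx →₀ F) :
    rightOp F K S c .e1 v (r1 i) = 0 := by
  classical
  refine linearCombination_apply_eq_zero (fun u => ?_) v
  rcases u with (_ | u) | u | u | (_ | u) | u | u | _ | (_ | u) | u | u | u <;>
    simp [rightVec]

lemma leftOp_e1_apply_r2 {i : ℕ} (v : Idx →₀ F) :
    leftOp F K S c .e1 v (r2 i) = v (r2 i) := by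
  classical
  refine linearCombination_apply_eq (fun u => ?_) v
  rcases u with (_ | u) | u | u | (_ | u) | u | u | _ | (_ | u) | u | u | u <;>
    simp [leftVec, Finsupp.single_apply]

lemma rightOp_e1_apply_r2 {i : ℕ} (v : Idx →₀ F) :
    rightOp F K S c .e1 v (r2 i) = 0 := by
  classical
  refine linearCombination_apply_eq_zero (fun u => ?_) v
  rcases u with (_ | u) | u | u | (_ | u) | u | u | _ | (_ | u) | u | u | u <;>
    simp [rightVec]

lemma leftOp_b_apply_r1 {i : ℕ} (hi : i ≤ K) (v : Idx →₀ F) :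
    leftOp F K S c .b v (r1 i) = v (r0 i) := by
  classical
  refine linearCombination_apply_eq (fun u => ?_) v
  rcases u with (_ | u) | u | u | (_ | u) | u | u | _ | (_ | u) | u | u | u <;>
    simp [leftVec, Finsupp.single_apply, P2, Q3, R1, apply_ite (fun f : Idx →₀ F => f (r1 i))]
  grind

lemma rightOp_b_apply_r1_zero (v : Idx →₀ F) :
    rightOp F K S c .b v (r1 0) = v (p0 0) := by
  classical
  refine linearCombination_apply_eq (fun u => ?_) v
  rcases u with (_ | u) | u | u | (_ | u) | u | u | _ | (_ | u) | u | u | u <;>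
    simp [rightVec, R0, R1, R2, apply_ite (fun f : Idx →₀ F => f (r1 0))]

lemma rightOp_b_apply_r1_succ {i : ℕ} (hi : i + 1 ≤ K) (v : Idx →₀ F) :
    rightOp F K S c .b v (r1 (i + 1)) = v (q3 i) := by
  classical
  refine linearCombination_apply_eq (fun u => ?_) v
  rcases u with (_ | u) | u | u | (_ | u) | u | u | _ | (_ | u) | u | u | u <;>
    simp [rightVec, Finsupp.single_apply, R0, R1, R2,
      apply_ite (fun f : Idx →₀ F => f (r1 (i + 1)))]
  grind

lemma leftOp_b_apply_r2 {i : ℕ} (v : Idx →₀ F) :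
    leftOp F K S c .b v (r2 i) = 0 := by
  classical
  refine linearCombination_apply_eq_zero (fun u => ?_) v
  rcases u with (_ | u) | u | u | (_ | u) | u | u | _ | (_ | u) | u | u | u <;>
    simp [leftVec, P2, Q3, R1, apply_ite (fun f : Idx →₀ F => f (r2 i))]

lemma rightOp_b_apply_r2 {i : ℕ} (hi : i ≤ K) (v : Idx →₀ F) :
    rightOp F K S c .b v (r2 i) = v (q1 i) := by
  classical
  refine linearCombination_apply_eq (fun u => ?_) v
  rcases u with (_ | u) | u | u | (_ | u) | u | u | _ | (_ | u) | u | u | u <;>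
    simp [rightVec, Finsupp.single_apply, R0, R1, R2, apply_ite (fun f : Idx →₀ F => f (r2 i))]
  grind

lemma leftOp_a_apply_q1 {i : ℕ} (hi : i + 1 ≤ K) (v : Idx →₀ F) :
    leftOp F K S c .a v (q1 (i + 1)) = v (q3 i) := by
  classical
  refine linearCombination_apply_eq (fun u => ?_) v
  rcases u with (_ | u) | u | u | (_ | u) | u | u | _ | (_ | u) | u | u | u <;>
    simp [leftVec, Finsupp.single_apply, P0, Q1, R2,
      apply_ite (fun f : Idx →₀ F => f (q1 (i + 1)))]
  grind

lemma rightOp_a_apply_q1 {i : ℕ} (hi : i + 1 ≤ K) (v : Idx →₀ F) :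
    rightOp F K S c .a v (q1 (i + 1)) = v (p0 (i + 1)) := by
  classical
  refine linearCombination_apply_eq (fun u => ?_) v
  rcases u with (_ | u) | u | u | (_ | u) | u | u | _ | (_ | u) | u | u | u <;>
    simp [rightVec, Finsupp.single_apply, Q1, Q2, Q3,
      apply_ite (fun f : Idx →₀ F => f (q1 (i + 1)))]
  grind

lemma leftOp_a_apply_q3 {i : ℕ} (v : Idx →₀ F) :
    leftOp F K S c .a v (q3 i) = 0 := by
  classical
  refine linearCombination_apply_eq_zero (fun u => ?_) v
  rcases u with (_ | u) | u | u | (_ | u) | u | u | _ | (_ | u) | u | u | u <;>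
    simp [leftVec, P0, Q1, R2, apply_ite (fun f : Idx →₀ F => f (q3 i))]

lemma rightOp_a_apply_q3 {i : ℕ} (hi : i < K) (v : Idx →₀ F) :
    rightOp F K S c .a v (q3 i) = v (p2 i) := by
  classical
  refine linearCombination_apply_eq (fun u => ?_) v
  rcases u with (_ | u) | u | u | (_ | u) | u | u | _ | (_ | u) | u | u | u <;>
    simp [rightVec, Finsupp.single_apply, Q1, Q2, Q3, apply_ite (fun f : Idx →₀ F => f (q3 i))]
  grind

/-- A central element is determined by its coordinates at the labels `centerLabel`. -/
lemma eq_zero_of_mem_center {x : DA F (K + 1) (S + 1) c}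
    (hx : x ∈ Subalgebra.center F (DA F (K + 1) (S + 1) c))
    (hl : ∀ j, coords c K S x (centerLabel K S j) = 0) : x = 0 := by
  rw [mem_center_iff] at hx
  rw [← toAlg_coords c K S x]
  set v := coords c K S x
  have hx' (t : Gen) (u : Idx) : leftOp F K S c t v u = rightOp F K S c t v u := by rw [hx]
  have hp0 : v (p0 0) = 0 := hl (.inl 0)
  have hp2 : v (p2 K) = 0 := hl (.inl 1)
  have hw : v w = 0 := hl (.inl 2)
  have hp0' {i : ℕ} (hi : i < K) : v (p0 (i + 1)) = 0 := hl (.inr (.inl ⟨i, hi⟩))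
  have hh {j : ℕ} (hj : j < S + 1) : v (h j) = 0 := hl (.inr (.inr ⟨j, hj⟩))
  have hq3 {i : ℕ} (hi : i < K) : v (q3 i) = 0 := by
    have := hx' .a (q1 (i + 1))
    rwa [leftOp_a_apply_q1 c K S hi, rightOp_a_apply_q1 c K S hi, hp0' hi] at this
  refine toAlg_eq_zero c K S fun u => ?_
  rcases u with (_ | i) | i | i | i | i | i | _ | (_ | i) | i | i | j
  · exact .inl hp0
  · by_cases hi : i < K
    · exact .inl (hp0' hi)
    · exact .inr (if_neg hi)
  · left
    simpa only [leftOp_e1_apply_p1, rightOp_e1_apply_p1, eq_comm] using hx' .e1 (p1 i)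
  · rcases lt_trichotomy i K with hi | rfl | hi
    · left
      have := hx' .a (q3 i)
      rwa [leftOp_a_apply_q3, rightOp_a_apply_q3 c K S hi, eq_comm] at this
    · exact .inl hp2
    · exact .inr (if_neg (by omega))
  · by_cases hi : i ≤ K
    · left
      have := hx' .b (r2 i)
      rwa [leftOp_b_apply_r2, rightOp_b_apply_r2 c K S hi, eq_comm] at this
    · exact .inr (if_neg hi)
  · left
    simpa only [leftOp_e1_apply_q2, rightOp_e1_apply_q2, eq_comm] using hx' .e1 (q2 i)
  · by_cases hi : i < K
    · exact .inl (hq3 hi)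
    · exact .inr (if_neg hi)
  · exact .inl hw
  · left
    have := hx' .b (r1 0)
    rwa [leftOp_b_apply_r1 c K S (Nat.zero_le K), rightOp_b_apply_r1_zero, hp0] at this
  · by_cases hi : i < K
    · left
      have := hx' .b (r1 (i + 1))
      rwa [leftOp_b_apply_r1 c K S hi, rightOp_b_apply_r1_succ c K S hi, hq3 hi] at this
    · exact .inr (if_neg hi)
  · left
    simpa only [leftOp_e1_apply_r1, rightOp_e1_apply_r1] using hx' .e1 (r1 i)
  · left
    simpa only [leftOp_e1_apply_r2, rightOp_e1_apply_r2] using hx' .e1 (r2 i)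
  · by_cases hj : j < S + 1
    · exact .inl (hh hj)
    · exact .inr (if_neg (by omega))

lemma span_range_centerFamily :
    Submodule.span F (Set.range (centerFamily c K S)) =
      Subalgebra.toSubmodule (Subalgebra.center F (DA F (K + 1) (S + 1) c)) := by
  classical
  apply le_antisymm
  · rw [Submodule.span_le]
    rintro _ ⟨j, rfl⟩
    exact centerFamily_mem_center c K S j
  · intro x hx
    set y := ∑ j, coords c K S x (centerLabel K S j) • centerFamily c K S j with hy
    have hxy : x - y = 0 := by
      refine eq_zero_of_mem_center c K S (sub_mem hx ?_) fun i => ?_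
      · exact sum_mem fun j _ => Subalgebra.smul_mem _ (centerFamily_mem_center c K S j) _
      · simp [-Fintype.sum_sum_type, hy, coords_centerFamily, centerVec_centerLabel]
    rw [sub_eq_zero.1 hxy]
    exact sum_mem fun j _ => Submodule.smul_mem _ _ (Submodule.subset_span ⟨j, rfl⟩)

end Model

set_option synthInstance.maxHeartbeats 1000000 in
/-- **Basis of the center of `A^{k,s}_c` (dihedral type).**  For `k, s ≥ 1` and
`c ∈ {0,1}` the set 𝓩 is an F-basis of `Z(A^{k,s}_c)`; in particular
`dim_F Z(A^{k,s}_c) = k + s + 2`. -/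
theorem dihedral_center_basis
    (F : Type) [Field F] [IsAlgClosed F] [CharP F 2]
    (k s : ℕ) (hk : 1 ≤ k) (hs : 1 ≤ s) (c : F) (hc : c = 0 ∨ c = 1) :
    LinearIndependent F (fun p : (ZZ F k s c) => (p : DA F k s c)) ∧
    Submodule.span F (ZZ F k s c)
      = Subalgebra.toSubmodule (Subalgebra.center F (DA F k s c)) ∧
    Module.finrank F ↥(Subalgebra.center F (DA F k s c)) = k + s + 2 := by
  obtain ⟨K, rfl⟩ := Nat.exists_eq_add_of_le' hk
  obtain ⟨S, rfl⟩ := Nat.exists_eq_add_of_le' hs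
  have hli := linearIndependent_centerFamily c K S
  have hspan := span_range_centerFamily c K S
  refine ⟨?_, ?_, ?_⟩
  · rw [← range_centerFamily]
    exact hli.linearIndepOn_id
  · rw [← range_centerFamily, hspan]
  · have hrank := finrank_span_eq_card hli
    rw [hspan] at hrank
    refine hrank.trans ?_
    simp only [Fintype.card_sum, Fintype.card_fin]
    omega

end DihedralPaper

end
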